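/- arXiv:math/0112087 — 3 statements merged into one kernel-verified Lean document; each statement's English description precedes it below -/
import Mathlib

section
/- Let (H, ⟨·,·⟩, l) be a Poincaré–Lefschetz space of dimension n. If the quadratic forms Q_l satisfy the Hodge–Riemann–Minkowski relations, then l is a Lefschetz operation centered at degree n, i.e. l^k : H^{n-k} → H^{n+k} is an isomorphism for every k > 0. -/
/-- `l` is a Lefschetz operation centered at degree `n` on the grading `H`:
`l^k : H^{n-k} → H^{n+k}` is an isomorphism for every `k > 0`. -/
def IsLefschetzOp {V : Type} [AddCommGroup V] [Module ℝ V]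
    (n : ℕ) (H : ℤ → Submodule ℝ V) (l : Module.End ℝ V) : Prop :=
  ∀ k : ℕ, 0 < k →
    (Submodule.map (l ^ k) (H ((n : ℤ) - k)) = H ((n : ℤ) + k)) ∧
    (∀ x ∈ H ((n : ℤ) - k), (l ^ k) x = 0 → x = 0)

/-- A Poincaré–Lefschetz space of dimension `n`: a finite-dimensional graded real
vector space `H = ⊕_{i=0}^{2n} H^i`, vanishing in odd degrees, with a symmetric
bilinear form pairing `H^i` with `H^{2n-i}` nondegenerately, and a self-adjoint
degree-2 operator `l`. -/
structure IsPLSpace {V : Type} [AddCommGroup V] [Module ℝ V]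
    (n : ℕ) (H : ℤ → Submodule ℝ V) (B : LinearMap.BilinForm ℝ V)
    (l : Module.End ℝ V) : Prop where
  finite : FiniteDimensional ℝ V
  internal : DirectSum.IsInternal H
  bound : ∀ i : ℤ, (i < 0 ∨ (2 * n : ℤ) < i) → H i = ⊥
  oddVanish : ∀ i : ℤ, Odd i → H i = ⊥
  symm : ∀ x y : V, B x y = B y x
  orthog : ∀ i j : ℤ, i + j ≠ 2 * n → ∀ x ∈ H i, ∀ y ∈ H j, B x y = 0
  nondeg : ∀ i : ℤ, ∀ x ∈ H i, (∀ y ∈ H (2 * n - i), B x y = 0) → x = 0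
  deg2 : ∀ i : ℤ, (H i).map l ≤ H (i + 2)
  selfAdjoint : ∀ x y : V, B (l x) y = B x (l y)

/-- The quadratic forms `Q_l(x) = ⟨l^{n-d} x, x⟩` satisfy the
Hodge–Riemann–Minkowski relations: `(-1)^{d/2} Q_l` is positive definite on the
primitive subspace `P^d = H^d ∩ ker l^{n-d+1}` for every even `0 ≤ d ≤ n`. -/
def SatisfiesHRM {V : Type} [AddCommGroup V] [Module ℝ V]
    (n : ℕ) (H : ℤ → Submodule ℝ V) (B : LinearMap.BilinForm ℝ V)
    (l : Module.End ℝ V) : Prop :=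
  ∀ d : ℕ, d ≤ n → Even d →
    ∀ x ∈ H (d : ℤ) ⊓ LinearMap.ker (l ^ (n - d + 1)), x ≠ 0 →
      0 < (-1 : ℝ) ^ (d / 2) * B ((l ^ (n - d)) x) x

section PLSpace

variable {V : Type} [AddCommGroup V] [Module ℝ V] {n : ℕ} {H : ℤ → Submodule ℝ V}
  {B : LinearMap.BilinForm ℝ V} {l : Module.End ℝ V}

theorem IsPLSpace.pow_mem (h : IsPLSpace n H B l) (k : ℕ) {i : ℤ} {x : V} (hx : x ∈ H i) :
    (l ^ k) x ∈ H (i + 2 * k) := by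
  induction k with
  | zero => simpa using hx
  | succ k ih =>
    rw [pow_succ', Module.End.mul_apply]
    have := h.deg2 _ (Submodule.mem_map_of_mem (f := l) ih)
    convert this using 2
    push_cast
    ring

theorem IsPLSpace.finrank_le (h : IsPLSpace n H B l) (i : ℤ) :
    Module.finrank ℝ (H i) ≤ Module.finrank ℝ (H (2 * n - i)) := by
  have := h.finite
  let f : H i →ₗ[ℝ] Module.Dual ℝ (H (2 * n - i)) :=
    B.domRestrict₁₂ (H i) (H (2 * n - i))
  have hf : Function.Injective f := by
    rw [injective_iff_map_eq_zero]
    intro x hx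
    refine Subtype.ext (h.nondeg i x x.2 fun y hy => ?_)
    exact LinearMap.congr_fun hx ⟨y, hy⟩
  simpa only [Subspace.dual_finrank_eq] using LinearMap.finrank_le_finrank_of_injective hf

theorem SatisfiesHRM.eq_zero_of_pow_eq_zero (h : IsPLSpace n H B l) (hHRM : SatisfiesHRM n H B l)
    (k : ℕ) {x : V} (hx : x ∈ H ((n : ℤ) - k)) (hlx : (l ^ k) x = 0) : x = 0 := by
  rcases lt_or_ge n k with hk | hk
  · rw [h.bound _ (Or.inl (by lia))] at hx
    simpa using hx
  obtain ⟨d, rfl⟩ := Nat.exists_eq_add_of_le' hk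
  have hd : ((d + k : ℕ) : ℤ) - k = d := by push_cast; ring
  rw [hd] at hx
  rcases Nat.even_or_odd d with hev | hodd
  · by_contra hne
    have hpos := hHRM d (Nat.le_add_right d k) hev x
      ⟨hx, by simp [pow_succ', hlx]⟩ hne
    simp [hlx] at hpos
  · rw [h.oddVanish _ (by exact_mod_cast hodd)] at hx
    simpa using hx

end PLSpace

/-- If the `Q_l` satisfy the Hodge–Riemann–Minkowski relations, then `l` is a
Lefschetz operation centered at degree `n`. -/
theorem stmt2 {V : Type} [AddCommGroup V] [Module ℝ V]
    (n : ℕ) (H : ℤ → Submodule ℝ V) (B : LinearMap.BilinForm ℝ V)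
    (l : Module.End ℝ V)
    (hPL : IsPLSpace n H B l)
    (hHRM : SatisfiesHRM n H B l) :
    IsLefschetzOp n H l := by
  have := hPL.finite
  intro k _
  have hinj : ∀ x ∈ H ((n : ℤ) - k), (l ^ k) x = 0 → x = 0 :=
    fun x hx => hHRM.eq_zero_of_pow_eq_zero hPL k hx
  refine ⟨Submodule.eq_of_le_of_finrank_le ?_ ?_, hinj⟩
  · rintro _ ⟨x, hx, rfl⟩
    convert hPL.pow_mem k hx using 2
    ring
  · have hf : Function.Injective ((l ^ k).domRestrict (H ((n : ℤ) - k))) := by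
      rw [injective_iff_map_eq_zero]
      exact fun x hx => Subtype.ext (hinj x x.2 hx)
    rw [← LinearMap.range_domRestrict, LinearMap.finrank_range_of_inj hf]
    have hdeg : (2 * n : ℤ) - (n + k) = n - k := by ring
    exact hdeg ▸ hPL.finrank_le ((n : ℤ) + k)
end

section
/- Let (H, ⟨·,·⟩, l) be a Poincaré–Lefschetz space of dimension n, and write h^j = dim H^j (with h^j = 0 for j < 0). For a real quadratic form, define its signature to be the pair (p, q) where p (resp. q) is the maximal dimension of a subspace on which the form is positive (resp. negative) definite. Then Q_l satisfies the Hodge–Riemann–Minkowski relations if and only if for every even k with 0 ≤ k ≤ n the signature of the quadratic form Q_l on H^k equals ( Σ_{0 ≤ j ≤ k, 4 | j} (h^j − h^{j−2}), Σ_{0 ≤ j ≤ k, j even, 4 ∤ j} (h^j − h^{j−2}) ). -/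
/-- The positive index of a (quadratic) form `Q` on a subspace `W`: the maximal
dimension of a subspace of `W` on which `Q` is positive definite. -/
noncomputable def posIndex {V : Type} [AddCommGroup V] [Module ℝ V]
    (Q : V → ℝ) (W : Submodule ℝ V) : ℕ :=
  sSup {m : ℕ | ∃ U : Submodule ℝ V, U ≤ W ∧ Module.finrank ℝ U = m ∧
    ∀ x ∈ U, x ≠ 0 → 0 < Q x}

/-- The negative index of a (quadratic) form `Q` on a subspace `W`: the maximal
dimension of a subspace of `W` on which `Q` is negative definite. -/
noncomputable def negIndex {V : Type} [AddCommGroup V] [Module ℝ V]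
    (Q : V → ℝ) (W : Submodule ℝ V) : ℕ :=
  sSup {m : ℕ | ∃ U : Submodule ℝ V, U ≤ W ∧ Module.finrank ℝ U = m ∧
    ∀ x ∈ U, x ≠ 0 → Q x < 0}

open Module Finset

/-- The bilinear form `C` is positive definite on the subspace `U`. -/
def PosDefOn {V : Type} [AddCommGroup V] [Module ℝ V]
    (C : LinearMap.BilinForm ℝ V) (U : Submodule ℝ V) : Prop :=
  ∀ x ∈ U, x ≠ 0 → 0 < C x x

/-- The subspace `W` contains a positive definite subspace of dimension `a` and a negative
definite subspace of dimension `b`. -/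
def HasDefinitePair {V : Type} [AddCommGroup V] [Module ℝ V]
    (C : LinearMap.BilinForm ℝ V) (W : Submodule ℝ V) (a b : ℤ) : Prop :=
  ∃ A N : Submodule ℝ V, A ≤ W ∧ N ≤ W ∧ (finrank ℝ A : ℤ) = a ∧ (finrank ℝ N : ℤ) = b ∧
    PosDefOn C A ∧ PosDefOn (-C) N

section Forms

variable {V : Type} [AddCommGroup V] [Module ℝ V]

theorem PosDefOn.eq_zero_of_mem {C : LinearMap.BilinForm ℝ V} {A N : Submodule ℝ V}
    (hA : PosDefOn C A) (hN : PosDefOn (-C) N) : ∀ x ∈ A, x ∈ N → x = 0 := fun x hx hx' => by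
  by_contra h0
  have h1 := hA x hx h0
  have h2 := hN x hx' h0
  simp only [LinearMap.neg_apply] at h2
  linarith

theorem HasDefinitePair.neg {C : LinearMap.BilinForm ℝ V} {W : Submodule ℝ V} {a b : ℤ}
    (h : HasDefinitePair C W a b) : HasDefinitePair (-C) W b a := by
  obtain ⟨A, N, hA, hN, ha, hb, hpos, hneg⟩ := h
  exact ⟨N, A, hN, hA, hb, ha, hneg, by simpa [PosDefOn] using hpos⟩

theorem HasDefinitePair.of_neg {C : LinearMap.BilinForm ℝ V} {W : Submodule ℝ V} {a b : ℤ}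
    (h : HasDefinitePair (-C) W a b) : HasDefinitePair C W b a := by
  obtain ⟨A, N, hA, hN, ha, hb, hpos, hneg⟩ := h
  exact ⟨N, A, hN, hA, hb, ha, by simpa [PosDefOn] using hneg, hpos⟩

theorem finrank_map_of_injOn {W U : Submodule ℝ V} {l : Module.End ℝ V}
    (hl : ∀ x ∈ W, l x = 0 → x = 0) (hU : U ≤ W) :
    finrank ℝ (U.map l) = finrank ℝ U := by
  rw [← LinearMap.range_domRestrict]
  apply LinearMap.finrank_range_of_inj
  rw [injective_iff_map_eq_zero]
  rintro ⟨x, hx⟩ h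
  exact Subtype.ext (hl x (hU hx) h)

theorem negIndex_eq_posIndex_neg (C : LinearMap.BilinForm ℝ V) (W : Submodule ℝ V) :
    negIndex (fun x => C x x) W = posIndex (fun x => (-C) x x) W := by
  simp [negIndex, posIndex]

variable [FiniteDimensional ℝ V]

theorem finrank_sup_of_disjoint {A N : Submodule ℝ V} (h : ∀ x ∈ A, x ∈ N → x = 0) :
    finrank ℝ (A ⊔ N : Submodule ℝ V) = finrank ℝ A + finrank ℝ N := by
  have hinf : A ⊓ N = ⊥ := (Submodule.eq_bot_iff _).2 fun x hx => h x hx.1 hx.2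
  rw [← Submodule.finrank_sup_add_finrank_inf_eq, hinf, finrank_bot, add_zero]

theorem finrank_add_le_of_disjoint {W A N : Submodule ℝ V} (hA : A ≤ W) (hN : N ≤ W)
    (h : ∀ x ∈ A, x ∈ N → x = 0) : finrank ℝ A + finrank ℝ N ≤ finrank ℝ W := by
  rw [← finrank_sup_of_disjoint h]
  exact Submodule.finrank_mono (sup_le hA hN)

theorem exists_finrank_eq_posIndex (Q : V → ℝ) (W : Submodule ℝ V) :
    ∃ U : Submodule ℝ V, U ≤ W ∧ finrank ℝ U = posIndex Q W ∧ ∀ x ∈ U, x ≠ 0 → 0 < Q x := by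
  refine Nat.sSup_mem (s := {m : ℕ | ∃ U : Submodule ℝ V, U ≤ W ∧ finrank ℝ U = m ∧
    ∀ x ∈ U, x ≠ 0 → 0 < Q x}) ⟨0, ⊥, bot_le, finrank_bot ℝ V, by simp +contextual⟩
    ⟨finrank ℝ W, ?_⟩
  rintro _ ⟨U, hU, rfl, -⟩
  exact Submodule.finrank_mono hU

theorem posIndex_eq_finrank {C : LinearMap.BilinForm ℝ V} {W A N : Submodule ℝ V}
    (hA : A ≤ W) (hN : N ≤ W) (hdim : finrank ℝ A + finrank ℝ N = finrank ℝ W)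
    (hpos : PosDefOn C A) (hneg : PosDefOn (-C) N) :
    posIndex (fun x => C x x) W = finrank ℝ A := by
  have hub : ∀ m ∈ {m : ℕ | ∃ U : Submodule ℝ V, U ≤ W ∧ finrank ℝ U = m ∧
      ∀ x ∈ U, x ≠ 0 → 0 < C x x}, m ≤ finrank ℝ A := by
    rintro _ ⟨U, hU, rfl, hUpos⟩
    have := finrank_add_le_of_disjoint hU hN (PosDefOn.eq_zero_of_mem hUpos hneg)
    omega
  exact le_antisymm (csSup_le' hub) (le_csSup ⟨_, hub⟩ ⟨A, hA, rfl, hpos⟩)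

theorem index_eq_iff_hasDefinitePair {C : LinearMap.BilinForm ℝ V} {W : Submodule ℝ V} {a b : ℤ}
    (hab : a + b = finrank ℝ W) :
    ((posIndex (fun x => C x x) W : ℤ) = a ∧ (negIndex (fun x => C x x) W : ℤ) = b) ↔
      HasDefinitePair C W a b := by
  rw [negIndex_eq_posIndex_neg]
  constructor
  · rintro ⟨rfl, rfl⟩
    obtain ⟨A, hA, hAdim, hpos⟩ := exists_finrank_eq_posIndex (fun x => C x x) W
    obtain ⟨N, hN, hNdim, hneg⟩ := exists_finrank_eq_posIndex (fun x => (-C) x x) W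
    exact ⟨A, N, hA, hN, by rw [hAdim], by rw [hNdim], hpos, hneg⟩
  · rintro ⟨A, N, hA, hN, rfl, rfl, hpos, hneg⟩
    have hdim : finrank ℝ A + finrank ℝ N = finrank ℝ W := by exact_mod_cast hab
    rw [posIndex_eq_finrank hA hN hdim hpos hneg,
      posIndex_eq_finrank hN hA (by omega) hneg (by simpa [PosDefOn] using hpos)]
    exact ⟨rfl, rfl⟩

/-- A symmetric form with complementary definite subspaces has trivial radical. -/
theorem HasDefinitePair.eq_zero_of_radical {C : LinearMap.BilinForm ℝ V} {W : Submodule ℝ V}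
    {a b : ℤ} (h : HasDefinitePair C W a b) (hab : a + b = finrank ℝ W)
    (hC : ∀ x y, C x y = C y x) {x : V} (hx : x ∈ W) (hrad : ∀ y, C x y = 0) : x = 0 := by
  obtain ⟨A, N, hA, hN, rfl, rfl, hpos, hneg⟩ := h
  have hW : A ⊔ N = W := Submodule.eq_of_le_of_finrank_eq (sup_le hA hN) (by
    rw [finrank_sup_of_disjoint (hpos.eq_zero_of_mem hneg)]; exact_mod_cast hab)
  rw [← hW] at hx
  obtain ⟨u, hu, v, hv, rfl⟩ := Submodule.mem_sup.1 hx
  have h1 := hrad u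
  have h2 := hrad v
  simp only [map_add, LinearMap.add_apply] at h1 h2
  rw [hC v u] at h1
  have hu0 : 0 ≤ C u u := by
    by_cases h0 : u = 0
    · simp [h0]
    · exact (hpos u hu h0).le
  have hv0 : C v v ≤ 0 := by
    by_cases h0 : v = 0
    · simp [h0]
    · simpa using (hneg v hv h0).le
  have hu' : u = 0 := by
    by_contra h0
    have := hpos u hu h0
    linarith
  have hv' : v = 0 := by
    by_contra h0
    have := hneg v hv h0
    simp only [LinearMap.neg_apply] at this
    linarith
  rw [hu', hv', add_zero]

/-- Adding an orthogonal positive definite subspace `P` to the isometric image of `W'`. -/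
theorem HasDefinitePair.map_sup {C C' : LinearMap.BilinForm ℝ V} {W W' P : Submodule ℝ V}
    {l : Module.End ℝ V} {a b : ℤ} (h : HasDefinitePair C' W' a b)
    (hlW : W'.map l ≤ W) (hPW : P ≤ W) (hinj : ∀ x ∈ W', l x = 0 → x = 0)
    (hC : ∀ x y, C x y = C y x) (hiso : ∀ x, C (l x) (l x) = C' x x)
    (horth : ∀ p ∈ P, ∀ y ∈ W', C p (l y) = 0) (hP : PosDefOn C P) :
    HasDefinitePair C W (a + finrank ℝ P) b := by
  obtain ⟨A, N, hA, hN, rfl, rfl, hpos, hneg⟩ := h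
  have hdisj : ∀ x ∈ A.map l, x ∈ P → x = 0 := by
    rintro _ ⟨y, hy, rfl⟩ hp
    by_contra h0
    exact (hP _ hp h0).ne' (horth _ hp y (hA hy))
  refine ⟨A.map l ⊔ P, N.map l, sup_le ((Submodule.map_mono hA).trans hlW) hPW,
    (Submodule.map_mono hN).trans hlW, ?_, ?_, ?_, ?_⟩
  · rw [finrank_sup_of_disjoint hdisj, finrank_map_of_injOn hinj hA]
    push_cast
    rfl
  · rw [finrank_map_of_injOn hinj hN]
  · intro x hx h0
    obtain ⟨_, ⟨y, hy, rfl⟩, p, hp, rfl⟩ := Submodule.mem_sup.1 hx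
    have h1 := horth p hp y (hA hy)
    have h2 := hC (l y) p
    have h3 := hiso y
    simp only [map_add, LinearMap.add_apply]
    by_cases hy0 : y = 0
    · subst hy0
      have := hP p hp (by simpa using h0)
      simpa using this
    · have h4 := hpos y hy hy0
      have h5 : 0 ≤ C p p := by
        by_cases hp0 : p = 0
        · simp [hp0]
        · exact (hP p hp hp0).le
      linarith
  · rintro _ ⟨y, hy, rfl⟩ h0
    have := hneg y hy (by rintro rfl; simp at h0)
    simpa [hiso] using this

/-- If passing from `W'` to `W` does not increase the negative index, then the form is positive
definite on any subspace orthogonal to and disjoint from the isometric image of `W'`. -/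
theorem HasDefinitePair.posDefOn_of_map {C C' : LinearMap.BilinForm ℝ V} {W W' P : Submodule ℝ V}
    {l : Module.End ℝ V} {a a' b : ℤ} (h' : HasDefinitePair C' W' a' b)
    (h : HasDefinitePair C W a b) (hab : a + b = finrank ℝ W)
    (hlW : W'.map l ≤ W) (hPW : P ≤ W) (hinj : ∀ x ∈ W', l x = 0 → x = 0)
    (hC : ∀ x y, C x y = C y x) (hiso : ∀ x, C (l x) (l x) = C' x x)
    (horth : ∀ p ∈ P, ∀ y ∈ W', C p (l y) = 0)
    (hdisj : ∀ y ∈ W', l y ∈ P → l y = 0) : PosDefOn C P := by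
  intro x hx hx0
  by_contra! hneg_x
  obtain ⟨-, N, -, hN, -, rfl, -, hneg⟩ := h'
  obtain ⟨A, -, hA, -, rfl, -, hpos, -⟩ := h
  have hNx : finrank ℝ (N.map l ⊔ Submodule.span ℝ {x} : Submodule ℝ V) =
      finrank ℝ N + 1 := by
    rw [finrank_sup_of_disjoint, finrank_map_of_injOn hinj hN, finrank_span_singleton hx0]
    rintro _ ⟨y, hy, rfl⟩ hyx
    exact hdisj y (hN hy) ((Submodule.span_singleton_le_iff_mem x P).2 hx hyx)
  have hle : N.map l ⊔ Submodule.span ℝ {x} ≤ W :=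
    sup_le ((Submodule.map_mono hN).trans hlW)
      ((Submodule.span_singleton_le_iff_mem x W).2 (hPW hx))
  have := finrank_add_le_of_disjoint hA hle fun z hzA hz => by
    by_contra hz0
    have hzpos := hpos z hzA hz0
    obtain ⟨_, ⟨y, hy, rfl⟩, p, hp, rfl⟩ := Submodule.mem_sup.1 hz
    obtain ⟨c, rfl⟩ := Submodule.mem_span_singleton.1 hp
    have h1 := horth x hx y (hN hy)
    have h2 := hC (l y) x
    have h3 : C' y y ≤ 0 := by
      by_cases hy0 : y = 0
      · simp [hy0]
      · simpa using (hneg y hy hy0).le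
    have h4 := hiso y
    simp only [map_add, LinearMap.add_apply, map_smul, LinearMap.smul_apply, smul_eq_mul,
      h2, h1] at hzpos
    nlinarith [mul_nonneg (mul_self_nonneg c) (neg_nonneg.2 hneg_x)]
  rw [hNx] at this
  omega

end Forms

theorem sum_range_succ_of_odd_eq_zero (f : ℕ → ℤ) (hf : ∀ j, Odd j → f j = 0) {k : ℕ}
    (hk : Even k) : ∑ j ∈ range (k + 1), f j = ∑ j ∈ range (k - 1), f j + f k := by
  obtain ⟨m, rfl⟩ := hk
  cases m with
  | zero => simp
  | succ m =>
    have e : m + 1 + (m + 1) - 1 = m + m + 1 := by omega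
    rw [e, sum_range_succ, show m + 1 + (m + 1) = (m + m + 1) + 1 by omega, sum_range_succ,
      hf (m + m + 1) ⟨m, by ring⟩, add_zero]

theorem neg_one_pow_half {k : ℕ} (hk : Even k) :
    (-1 : ℝ) ^ (k / 2) = if 4 ∣ k then 1 else -1 := by
  obtain ⟨m, rfl⟩ := hk
  rw [show (m + m) / 2 = m by omega]
  split_ifs with h
  · exact Even.neg_one_pow (by rw [Nat.even_iff]; omega)
  · exact Odd.neg_one_pow (by rw [Nat.odd_iff]; omega)

/-- The sum of `h^j - h^{j-2}` over the indices `j < m` divisible by four. -/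
noncomputable def posSum {V : Type} [AddCommGroup V] [Module ℝ V] (H : ℤ → Submodule ℝ V)
    (m : ℕ) : ℤ :=
  ∑ j ∈ range m, if 4 ∣ j then
    ((finrank ℝ (H (j : ℤ)) : ℤ) - finrank ℝ (H ((j : ℤ) - 2))) else 0

/-- The sum of `h^j - h^{j-2}` over the even indices `j < m` not divisible by four. -/
noncomputable def negSum {V : Type} [AddCommGroup V] [Module ℝ V] (H : ℤ → Submodule ℝ V)
    (m : ℕ) : ℤ :=
  ∑ j ∈ range m, if Even j ∧ ¬ (4 ∣ j) then
    ((finrank ℝ (H (j : ℤ)) : ℤ) - finrank ℝ (H ((j : ℤ) - 2))) else 0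

section Sums

variable {V : Type} [AddCommGroup V] [Module ℝ V] (H : ℤ → Submodule ℝ V)

theorem posSum_succ {k : ℕ} (hk : Even k) :
    posSum H (k + 1) = posSum H (k - 1) + if 4 ∣ k then
      ((finrank ℝ (H (k : ℤ)) : ℤ) - finrank ℝ (H ((k : ℤ) - 2))) else 0 :=
  sum_range_succ_of_odd_eq_zero _ (fun j hj => if_neg fun h => by
    rw [Nat.odd_iff] at hj; omega) hk

theorem negSum_succ {k : ℕ} (hk : Even k) :
    negSum H (k + 1) = negSum H (k - 1) + if 4 ∣ k then 0 else
      ((finrank ℝ (H (k : ℤ)) : ℤ) - finrank ℝ (H ((k : ℤ) - 2))) := by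
  refine (sum_range_succ_of_odd_eq_zero _ (fun j hj => if_neg fun h => by
    rw [Nat.odd_iff] at hj; rw [Nat.even_iff] at h; omega) hk).trans ?_
  by_cases h : 4 ∣ k <;> simp [negSum, h, hk]

theorem posSum_add_negSum (h0 : H (-2) = ⊥) {k : ℕ} (hk : Even k) :
    posSum H (k + 1) + negSum H (k + 1) = finrank ℝ (H k) := by
  obtain ⟨m, rfl⟩ := hk
  induction m with
  | zero =>
    have : finrank ℝ (H (-2)) = 0 := by rw [h0, finrank_bot]
    simp [posSum, negSum, this]
  | succ m ih =>
    have he : Even (m + 1 + (m + 1)) := ⟨m + 1, rfl⟩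
    rw [posSum_succ H he, negSum_succ H he, show m + 1 + (m + 1) - 1 = m + m + 1 by omega,
      show ((m + 1 + (m + 1) : ℕ) : ℤ) - 2 = ((m + m : ℕ) : ℤ) by push_cast; ring]
    split_ifs <;> linarith

end Sums

namespace IsPLSpace

variable {V : Type} [AddCommGroup V] [Module ℝ V]
  {n : ℕ} {H : ℤ → Submodule ℝ V} {B : LinearMap.BilinForm ℝ V} {l : Module.End ℝ V}

theorem pow_selfAdjoint (h : IsPLSpace n H B l) (i : ℕ) (x y : V) :
    B ((l ^ i) x) y = B x ((l ^ i) y) := by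
  induction i generalizing x y with
  | zero => rfl
  | succ i ih => rw [pow_succ, Module.End.mul_apply, ih, h.selfAdjoint, ← Module.End.mul_apply,
      ← pow_succ', pow_succ]

theorem form_symm (h : IsPLSpace n H B l) (i : ℕ) (x y : V) :
    (B ∘ₗ l ^ i) x y = (B ∘ₗ l ^ i) y x := by
  simp only [LinearMap.comp_apply]
  rw [h.pow_selfAdjoint, h.symm]

theorem pow_mem_s5 (h : IsPLSpace n H B l) (i : ℕ) {j : ℤ} {x : V} (hx : x ∈ H j) :
    (l ^ i) x ∈ H (j + 2 * i) := by
  induction i with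
  | zero => simpa using hx
  | succ i ih =>
    rw [pow_succ', Module.End.mul_apply]
    have := h.deg2 _ (Submodule.mem_map_of_mem ih)
    rwa [show j + 2 * ((i + 1 : ℕ) : ℤ) = j + 2 * i + 2 by push_cast; ring]

theorem form_map (h : IsPLSpace n H B l) (i : ℕ) (x y : V) :
    (B ∘ₗ l ^ i) x (l y) = B ((l ^ (i + 1)) x) y := by
  rw [LinearMap.comp_apply, ← h.selfAdjoint, pow_succ', Module.End.mul_apply]

theorem form_map_map (h : IsPLSpace n H B l) (i : ℕ) (x : V) :
    (B ∘ₗ l ^ i) (l x) (l x) = (B ∘ₗ l ^ (i + 2)) x x := by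
  rw [h.form_map, LinearMap.comp_apply, ← Module.End.mul_apply, ← pow_succ]

theorem finrank_le_dual (h : IsPLSpace n H B l) (i : ℤ) :
    finrank ℝ (H i) ≤ finrank ℝ (H (2 * n - i)) := by
  have := h.finite
  rw [← Subspace.dual_finrank_eq (K := ℝ) (V := H (2 * n - i))]
  refine LinearMap.finrank_le_finrank_of_injective
    (f := (Submodule.dualRestrict (H (2 * n - i))) ∘ₗ (B.domRestrict (H i))) ?_
  rw [injective_iff_map_eq_zero]
  rintro ⟨x, hx⟩ h0
  refine Subtype.ext (h.nondeg i x hx fun y hy => ?_)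
  exact LinearMap.congr_fun h0 ⟨y, hy⟩

/-- The dimension of the primitive subspace in degree `k`, when `l ^ (n - k + 2)` is injective
in degree `k - 2`. -/
theorem finrank_primitive (h : IsPLSpace n H B l) {k : ℕ} (hk : k ≤ n)
    (hinj : ∀ x ∈ H ((k : ℤ) - 2), (l ^ (n - k + 2)) x = 0 → x = 0) :
    (finrank ℝ (H (k : ℤ) ⊓ LinearMap.ker (l ^ (n - k + 1)) : Submodule ℝ V) : ℤ) =
      (finrank ℝ (H (k : ℤ)) : ℤ) - finrank ℝ (H ((k : ℤ) - 2)) := by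
  have := h.finite
  set P := H (k : ℤ) ⊓ LinearMap.ker (l ^ (n - k + 1)) with hP
  have hpow : ∀ x, (l ^ (n - k + 2)) x = (l ^ (n - k + 1)) (l x) := fun x => by
    rw [← Module.End.mul_apply, ← pow_succ]
  have hl : ∀ x ∈ H ((k : ℤ) - 2), l x = 0 → x = 0 := fun x hx h0 =>
    hinj x hx (by rw [hpow, h0, map_zero])
  have hlW : (H ((k : ℤ) - 2)).map l ≤ H k := by simpa using h.deg2 ((k : ℤ) - 2)
  have hle := finrank_add_le_of_disjoint (A := P) inf_le_left hlW (by
    rintro _ hp ⟨y, hy, rfl⟩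
    rw [hinj y hy ((hpow y).trans hp.2), map_zero])
  rw [finrank_map_of_injOn hl le_rfl] at hle
  have hrank := LinearMap.finrank_range_add_finrank_ker
    ((l ^ (n - k + 1)).domRestrict (H (k : ℤ)))
  have hrange : finrank ℝ (LinearMap.range ((l ^ (n - k + 1)).domRestrict (H (k : ℤ)))) ≤
      finrank ℝ (H ((k : ℤ) - 2)) := by
    have hsub : LinearMap.range ((l ^ (n - k + 1)).domRestrict (H (k : ℤ))) ≤
        H (2 * n - ((k : ℤ) - 2)) := by
      rintro _ ⟨⟨x, hx⟩, rfl⟩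
      have := h.pow_mem_s5 (n - k + 1) hx
      rwa [show (k : ℤ) + 2 * ((n - k + 1 : ℕ) : ℤ) = 2 * n - ((k : ℤ) - 2) by omega] at this
    refine (Submodule.finrank_mono hsub).trans ?_
    have := h.finrank_le_dual (2 * n - ((k : ℤ) - 2))
    rwa [sub_sub_cancel] at this
  have hker : finrank ℝ (LinearMap.ker ((l ^ (n - k + 1)).domRestrict (H (k : ℤ)))) ≤
      finrank ℝ P := by
    rw [(Submodule.equivMapOfInjective _ (H (k : ℤ)).injective_subtype _).finrank_eq]
    refine Submodule.finrank_mono ?_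
    rintro _ ⟨⟨x, hx⟩, h0, rfl⟩
    exact ⟨hx, h0⟩
  omega

theorem satisfiesHRM_iff (n : ℕ) (H : ℤ → Submodule ℝ V) (B : LinearMap.BilinForm ℝ V)
    (l : Module.End ℝ V) : SatisfiesHRM n H B l ↔ ∀ k : ℕ, k ≤ n → Even k →
      PosDefOn (if 4 ∣ k then B ∘ₗ l ^ (n - k) else -(B ∘ₗ l ^ (n - k)))
        (H (k : ℤ) ⊓ LinearMap.ker (l ^ (n - k + 1))) := by
  refine forall₃_congr fun k hk he => forall₂_congr fun x hx => ?_
  rw [neg_one_pow_half he]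
  split_ifs <;> simp

/-- If `l ^ (n - d)` is injective on `H^d` in all even degrees `d ≤ n`, then `l ^ (n - k + 2)` is
injective on `H^{k-2}`, also for `k = 0`. -/
theorem injOn_sub_two (h : IsPLSpace n H B l)
    (hinj : ∀ d : ℕ, d ≤ n → Even d → ∀ x ∈ H (d : ℤ), (l ^ (n - d)) x = 0 → x = 0)
    {k : ℕ} (hk : k ≤ n) (he : Even k) :
    ∀ x ∈ H ((k : ℤ) - 2), (l ^ (n - k + 2)) x = 0 → x = 0 := by
  obtain ⟨m, rfl⟩ := he
  cases m with
  | zero =>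
    intro x hx _
    rwa [h.bound _ (Or.inl (by simp)), Submodule.mem_bot] at hx
  | succ m =>
    have := hinj (m + m) (by omega) ⟨m, rfl⟩
    rwa [show ((m + m : ℕ) : ℤ) = ((m + 1 + (m + 1) : ℕ) : ℤ) - 2 by push_cast; ring,
      show n - (m + m) = n - (m + 1 + (m + 1)) + 2 by omega] at this

/-- A definite pair in degree `k - 2`, given one in all smaller even degrees. -/
theorem hasDefinitePair_sub_two {k : ℕ} (hk : k ≤ n) (he : Even k)
    (hpair : ∀ d : ℕ, d < k → Even d →
      HasDefinitePair (B ∘ₗ l ^ (n - d)) (H (d : ℤ)) (posSum H (d + 1)) (negSum H (d + 1))) :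
    HasDefinitePair (B ∘ₗ l ^ (n - k + 2)) (H ((k : ℤ) - 2))
      (posSum H (k - 1)) (negSum H (k - 1)) := by
  obtain ⟨m, rfl⟩ := he
  cases m with
  | zero =>
    exact ⟨⊥, ⊥, bot_le, bot_le, by simp [posSum], by simp [negSum],
      by simp +contextual [PosDefOn], by simp +contextual [PosDefOn]⟩
  | succ m =>
    have := hpair (m + m) (by omega) ⟨m, rfl⟩
    rwa [show ((m + m : ℕ) : ℤ) = ((m + 1 + (m + 1) : ℕ) : ℤ) - 2 by push_cast; ring,
      show n - (m + m) = n - (m + 1 + (m + 1)) + 2 by omega,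
      show m + m + 1 = m + 1 + (m + 1) - 1 by omega] at this

theorem satisfiesHRM_iff_hasDefinitePair (h : IsPLSpace n H B l) :
    SatisfiesHRM n H B l ↔ ∀ k : ℕ, k ≤ n → Even k →
      HasDefinitePair (B ∘ₗ l ^ (n - k)) (H (k : ℤ)) (posSum H (k + 1)) (negSum H (k + 1)) := by
  have := h.finite
  have hlW (k : ℕ) : (H ((k : ℤ) - 2)).map l ≤ H k := by simpa using h.deg2 ((k : ℤ) - 2)
  have hpow (i : ℕ) (x : V) : (l ^ (i + 1)) (l x) = (l ^ (i + 2)) x := by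
    rw [← Module.End.mul_apply, ← pow_succ]
  have hinj_l (k : ℕ) (hinj : ∀ x ∈ H ((k : ℤ) - 2), (l ^ (n - k + 2)) x = 0 → x = 0) :
      ∀ x ∈ H ((k : ℤ) - 2), l x = 0 → x = 0 := fun x hx h0 =>
    hinj x hx (by rw [← hpow, h0, map_zero])
  have horth (k : ℕ) : ∀ p ∈ H (k : ℤ) ⊓ LinearMap.ker (l ^ (n - k + 1)),
      ∀ y ∈ H ((k : ℤ) - 2), (B ∘ₗ l ^ (n - k)) p (l y) = 0 := fun p hp y _ => by
    rw [h.form_map, LinearMap.mem_ker.1 hp.2, map_zero, LinearMap.zero_apply]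
  have hsymm (k : ℕ) := h.form_symm (n - k)
  have hiso (k : ℕ) := h.form_map_map (n - k)
  have hneg_symm (k : ℕ) (x y : V) :
      (-(B ∘ₗ l ^ (n - k))) x y = (-(B ∘ₗ l ^ (n - k))) y x := by
    simpa using hsymm k x y
  have hneg_iso (k : ℕ) (x : V) :
      (-(B ∘ₗ l ^ (n - k))) (l x) (l x) = (-(B ∘ₗ l ^ (n - k + 2))) x x := by
    simpa using hiso k x
  have hneg_orth (k : ℕ) : ∀ p ∈ H (k : ℤ) ⊓ LinearMap.ker (l ^ (n - k + 1)),
      ∀ y ∈ H ((k : ℤ) - 2), (-(B ∘ₗ l ^ (n - k))) p (l y) = 0 := fun p hp y hy => by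
    simpa using horth k p hp y hy
  have hsum {k : ℕ} (he : Even k) :=
    posSum_add_negSum H (h.bound (-2) (Or.inl (by norm_num))) he
  rw [satisfiesHRM_iff]
  constructor
  · intro hHRM
    have hinj : ∀ d : ℕ, d ≤ n → Even d → ∀ x ∈ H (d : ℤ), (l ^ (n - d)) x = 0 → x = 0 := by
      intro d hd he x hx h0
      by_contra hx0
      have := hHRM d hd he x ⟨hx, by
        rw [SetLike.mem_coe, LinearMap.mem_ker, pow_succ', Module.End.mul_apply, h0, map_zero]⟩ hx0
      split_ifs at this <;> simp [h0] at this
    intro k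
    induction k using Nat.strong_induction_on with
    | _ k ih =>
      intro hk he
      have hprev := hasDefinitePair_sub_two hk he fun d hd => ih d hd (by omega)
      have hinj' := h.injOn_sub_two hinj hk he
      have hdef := hHRM k hk he
      rw [posSum_succ H he, negSum_succ H he]
      split_ifs at hdef ⊢
      · rw [← h.finrank_primitive hk hinj', add_zero]
        exact hprev.map_sup (hlW k) inf_le_left (hinj_l k hinj') (hsymm k) (hiso k) (horth k) hdef
      · rw [← h.finrank_primitive hk hinj', add_zero]
        exact HasDefinitePair.of_neg (hprev.neg.map_sup (hlW k) inf_le_left (hinj_l k hinj') (hneg_symm k) (hneg_iso k)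
          (hneg_orth k) hdef)
  · intro hpair k hk he
    have hinj : ∀ d : ℕ, d ≤ n → Even d → ∀ x ∈ H (d : ℤ), (l ^ (n - d)) x = 0 → x = 0 :=
      fun d hd he x hx h0 => (hpair d hd he).eq_zero_of_radical (hsum he) (hsymm d) hx
        fun y => by simp [h0]
    have hinj' := h.injOn_sub_two hinj hk he
    have hprev := hasDefinitePair_sub_two hk he fun d hd => hpair d (by omega)
    have hcur := hpair k hk he
    have hdim := hsum he
    have hdisj : ∀ y ∈ H ((k : ℤ) - 2),
        l y ∈ H (k : ℤ) ⊓ LinearMap.ker (l ^ (n - k + 1)) → l y = 0 := fun y hy hp => by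
      rw [hinj' y hy ((hpow _ y).symm.trans hp.2), map_zero]
    have hpos := posSum_succ H he
    have hneg := negSum_succ H he
    split_ifs at hpos hneg ⊢
    · rw [add_zero] at hneg
      rw [← hneg] at hprev
      exact hprev.posDefOn_of_map hcur hdim (hlW k) inf_le_left (hinj_l k hinj') (hsymm k)
        (hiso k) (horth k) hdisj
    · rw [add_zero] at hpos
      rw [← hpos] at hprev
      exact hprev.neg.posDefOn_of_map hcur.neg (by rw [add_comm, hdim]) (hlW k) inf_le_left
        (hinj_l k hinj') (hneg_symm k) (hneg_iso k) (hneg_orth k) hdisj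

end IsPLSpace

/-- `Q_l` satisfies the Hodge–Riemann–Minkowski relations iff for every even
`k ≤ n` the signature of `Q_l` on `H^k` is
`(Σ_{0 ≤ j ≤ k, 4 | j} (h^j − h^{j-2}), Σ_{0 ≤ j ≤ k, j even, 4 ∤ j} (h^j − h^{j-2}))`,
where `h^j = dim H^j`. -/
theorem stmt5 {V : Type} [AddCommGroup V] [Module ℝ V]
    (n : ℕ) (H : ℤ → Submodule ℝ V) (B : LinearMap.BilinForm ℝ V)
    (l : Module.End ℝ V)
    (hPL : IsPLSpace n H B l) :
    SatisfiesHRM n H B l ↔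
      ∀ k : ℕ, k ≤ n → Even k →
        ((posIndex (fun x => B ((l ^ (n - k)) x) x) (H (k : ℤ)) : ℤ) =
          ∑ j ∈ Finset.range (k + 1), if 4 ∣ j then
            ((Module.finrank ℝ (H (j : ℤ)) : ℤ) - Module.finrank ℝ (H ((j : ℤ) - 2)))
          else 0) ∧
        ((negIndex (fun x => B ((l ^ (n - k)) x) x) (H (k : ℤ)) : ℤ) =
          ∑ j ∈ Finset.range (k + 1), if Even j ∧ ¬ (4 ∣ j) then
            ((Module.finrank ℝ (H (j : ℤ)) : ℤ) - Module.finrank ℝ (H ((j : ℤ) - 2)))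
          else 0) := by
  have := hPL.finite
  rw [hPL.satisfiesHRM_iff_hasDefinitePair]
  refine forall₃_congr fun k _ he => ?_
  rw [← index_eq_iff_hasDefinitePair
    (posSum_add_negSum H (hPL.bound (-2) (Or.inl (by norm_num))) he)]
  rfl
end

section
/- Let k_1, k_2 be nonnegative integers, n = k_1 + k_2, and let R = ℝ[x, y]/(x^{k_1+1}, y^{k_2+1}), graded by R_m = span{ x^i y^j : i + j = m, 0 ≤ i ≤ k_1, 0 ≤ j ≤ k_2 }. Let a, b be positive real numbers and let λ = a·x + b·y ∈ R_1. Then for every integer m with 0 ≤ m ≤ n/2, multiplication by λ^{n−2m} is a linear isomorphism R_m → R_{n−m}. -/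
open MvPolynomial

/-- The ideal `(x^{k₁+1}, y^{k₂+1})` in `ℝ[x, y]`. -/
noncomputable abbrev projIdeal (k₁ k₂ : ℕ) : Ideal (MvPolynomial (Fin 2) ℝ) :=
  Ideal.span {(X 0 : MvPolynomial (Fin 2) ℝ) ^ (k₁ + 1), (X 1 : MvPolynomial (Fin 2) ℝ) ^ (k₂ + 1)}

/-- The ring `R = ℝ[x, y]/(x^{k₁+1}, y^{k₂+1})`. -/
abbrev QR (k₁ k₂ : ℕ) : Type :=
  MvPolynomial (Fin 2) ℝ ⧸ projIdeal k₁ k₂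

/-- The graded piece `R_m`, spanned by the images of the monomials `x^i y^j`
with `i + j = m`, `0 ≤ i ≤ k₁`, `0 ≤ j ≤ k₂`. -/
noncomputable def Rm (k₁ k₂ m : ℕ) : Submodule ℝ (QR k₁ k₂) :=
  Submodule.span ℝ { q : QR k₁ k₂ | ∃ i j : ℕ, i + j = m ∧ i ≤ k₁ ∧ j ≤ k₂ ∧
    q = Ideal.Quotient.mk (projIdeal k₁ k₂) (X 0 ^ i * X 1 ^ j) }

/-- A polynomial with at most `N` terms that vanishes to order `N` at a nonzero point is zero. -/
theorem Polynomial.eq_zero_of_X_sub_C_pow_dvd {c : ℝ} (hc : c ≠ 0) (N : ℕ) (p : Polynomial ℝ)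
    (hdvd : (Polynomial.X - Polynomial.C c) ^ N ∣ p) (hcard : p.support.card ≤ N) : p = 0 := by
  induction N generalizing p with
  | zero => simpa using hcard
  | succ N ih =>
    by_contra hp
    obtain ⟨e, he⟩ := Polynomial.support_nonempty.mpr hp
    set q : Polynomial ℝ :=
      Polynomial.X * Polynomial.derivative p - Polynomial.C (e : ℝ) * p with hq
    have hcoeff (i : ℕ) : q.coeff i = ((i : ℝ) - e) * p.coeff i := by
      cases i with
      | zero => simp [hq]
      | succ i =>
        simp only [hq, Polynomial.coeff_sub, Polynomial.coeff_X_mul,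
          Polynomial.coeff_derivative, Polynomial.coeff_C_mul]
        push_cast
        ring
    have hsupp : q.support ⊆ p.support.erase e := by
      intro i hi
      rw [Polynomial.mem_support_iff, hcoeff] at hi
      rw [Finset.mem_erase, Polynomial.mem_support_iff]
      exact ⟨fun h => hi (by simp [h]), right_ne_zero_of_mul hi⟩
    have hq0 : q = 0 := by
      refine ih q (dvd_sub (Dvd.dvd.mul_left ?_ _) (Dvd.dvd.mul_left ?_ _)) ?_
      · have := Polynomial.pow_sub_one_dvd_derivative_of_pow_dvd hdvd
        rwa [Nat.add_sub_cancel] at this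
      · exact (pow_dvd_pow _ N.le_succ).trans hdvd
      · have := Finset.card_le_card hsupp
        rw [Finset.card_erase_of_mem he] at this
        omega
    have hmono : p = Polynomial.monomial e (p.coeff e) := by
      ext i
      rw [Polynomial.coeff_monomial]
      split_ifs with h
      · rw [h]
      · have := hcoeff i
        rw [hq0, Polynomial.coeff_zero, eq_comm, mul_eq_zero, sub_eq_zero] at this
        exact this.resolve_left fun h' => h (by exact_mod_cast h'.symm)
    have hroot : p.eval c = 0 :=
      Polynomial.dvd_iff_isRoot.mp ((dvd_pow_self _ N.succ_ne_zero).trans hdvd)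
    rw [hmono, Polynomial.eval_monomial] at hroot
    exact Polynomial.mem_support_iff.mp he ((mul_eq_zero.mp hroot).resolve_right (pow_ne_zero e hc))

theorem coeff_eq_zero_of_mem_projIdeal {k₁ k₂ : ℕ} {p : MvPolynomial (Fin 2) ℝ}
    (hp : p ∈ projIdeal k₁ k₂) {s : Fin 2 →₀ ℕ} (h₁ : s 0 ≤ k₁) (h₂ : s 1 ≤ k₂) :
    p.coeff s = 0 := by
  have hI : projIdeal k₁ k₂ = Ideal.span ((fun s => monomial s (1 : ℝ)) ''
      {Finsupp.single 0 (k₁ + 1), Finsupp.single 1 (k₂ + 1)}) := by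
    simp [projIdeal, Set.image_pair, X_pow_eq_monomial]
  rw [hI, mem_ideal_span_monomial_image] at hp
  by_contra hs
  obtain ⟨t, rfl | rfl, ht⟩ := hp s (mem_support_iff.mpr hs)
  · have := ht 0
    simp at this
    omega
  · have := ht 1
    simp at this
    omega

/-- The class in `R` of the degree `d` homogenization of a univariate polynomial. -/
noncomputable def homogClass (k₁ k₂ d : ℕ) : Polynomial ℝ →ₗ[ℝ] QR k₁ k₂ :=
  (Ideal.Quotient.mkₐ ℝ (projIdeal k₁ k₂)).toLinearMap ∘ₗ Polynomial.homogenizeLM d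

theorem homogClass_apply (k₁ k₂ d : ℕ) (p : Polynomial ℝ) :
    homogClass k₁ k₂ d p = Ideal.Quotient.mk (projIdeal k₁ k₂) (p.homogenize d) := rfl

theorem homogClass_X_pow (k₁ k₂ : ℕ) {d i : ℕ} (h : i ≤ d) :
    homogClass k₁ k₂ d (Polynomial.X ^ i) =
      Ideal.Quotient.mk (projIdeal k₁ k₂) (X 0 ^ i * X 1 ^ (d - i)) := by
  rw [homogClass_apply, Polynomial.homogenize_X_pow h]

theorem homogClass_mul (k₁ k₂ : ℕ) {d e : ℕ} {p q : Polynomial ℝ} (hp : p.natDegree ≤ d)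
    (hq : q.natDegree ≤ e) :
    homogClass k₁ k₂ (d + e) (p * q) = homogClass k₁ k₂ d p * homogClass k₁ k₂ e q := by
  simp only [homogClass_apply, Polynomial.homogenize_mul p q hp hq, map_mul]

theorem homogClass_pow (k₁ k₂ : ℕ) {p : Polynomial ℝ} (hp : p.natDegree ≤ 1) (N : ℕ) :
    homogClass k₁ k₂ N (p ^ N) = homogClass k₁ k₂ 1 p ^ N := by
  induction N with
  | zero => simp [homogClass_apply]
  | succ N ih =>
    rw [pow_succ, pow_succ, homogClass_mul k₁ k₂ _ hp, ih]
    simpa using Polynomial.natDegree_pow_le_of_le N hp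

/-- The exponents `i` such that `x^i y^(d-i)` is a nonzero monomial of degree `d` in `R`. -/
def monomialExponents (k₁ k₂ d : ℕ) : Finset ℕ := Finset.Icc (d - k₂) (min k₁ d)

theorem Rm_eq_span_range (k₁ k₂ d : ℕ) :
    Rm k₁ k₂ d = Submodule.span ℝ (Set.range fun i : monomialExponents k₁ k₂ d =>
      homogClass k₁ k₂ d (Polynomial.X ^ (i : ℕ))) := by
  rw [Rm]
  congr 1
  ext q
  simp only [Set.mem_ofPred_eq, Set.mem_range, Subtype.exists, monomialExponents, Finset.mem_Icc]
  constructor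
  · rintro ⟨i, j, rfl, hi, hj, rfl⟩
    exact ⟨i, by omega, by rw [homogClass_X_pow _ _ (by omega), Nat.add_sub_cancel_left]⟩
  · rintro ⟨i, hi, rfl⟩
    exact ⟨i, d - i, by omega, by omega, by omega, homogClass_X_pow _ _ (by omega)⟩

theorem mk_X_pow_mul_X_pow_mem_Rm (k₁ k₂ i j : ℕ) :
    Ideal.Quotient.mk (projIdeal k₁ k₂) (X 0 ^ i * X 1 ^ j) ∈ Rm k₁ k₂ (i + j) := by
  by_cases hi : i ≤ k₁
  · by_cases hj : j ≤ k₂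
    · exact Submodule.subset_span ⟨i, j, rfl, hi, hj, rfl⟩
    · rw [Ideal.Quotient.eq_zero_iff_mem.mpr]
      · exact zero_mem _
      · exact Ideal.mul_mem_left _ _ (Ideal.mem_of_dvd _ (pow_dvd_pow _ (by omega))
          (Ideal.subset_span (Set.mem_insert_of_mem _ rfl)))
  · rw [Ideal.Quotient.eq_zero_iff_mem.mpr]
    · exact zero_mem _
    · exact Ideal.mul_mem_right _ _ (Ideal.mem_of_dvd _ (pow_dvd_pow _ (by omega))
        (Ideal.subset_span (Set.mem_insert _ _)))

theorem homogClass_mem_Rm (k₁ k₂ d : ℕ) (p : Polynomial ℝ) :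
    homogClass k₁ k₂ d p ∈ Rm k₁ k₂ d := by
  induction p using Polynomial.induction_on' with
  | add p q hp hq => rw [map_add]; exact add_mem hp hq
  | monomial i c =>
    rw [← mul_one c, ← smul_eq_mul, ← Polynomial.smul_monomial, map_smul,
      ← Polynomial.X_pow_eq_monomial]
    refine Submodule.smul_mem _ _ ?_
    by_cases hi : i ≤ d
    · rw [homogClass_X_pow _ _ hi]
      simpa [hi] using mk_X_pow_mul_X_pow_mem_Rm k₁ k₂ i (d - i)
    · rw [homogClass_apply, Polynomial.X_pow_eq_monomial,
        Polynomial.homogenize_monomial_of_lt (by omega), map_zero]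
      exact zero_mem _

theorem coeff_eq_zero_of_homogClass_eq_zero {k₁ k₂ d : ℕ} {p : Polynomial ℝ}
    (hp : homogClass k₁ k₂ d p = 0) {i : ℕ} (hi : i ∈ monomialExponents k₁ k₂ d) :
    p.coeff i = 0 := by
  rw [homogClass_apply, Ideal.Quotient.eq_zero_iff_mem] at hp
  rw [monomialExponents, Finset.mem_Icc] at hi
  have := coeff_eq_zero_of_mem_projIdeal hp
    (s := Finsupp.single 0 i + Finsupp.single 1 (d - i)) (by simp; omega) (by simp; omega)
  rw [Polynomial.coeff_homogenize] at this
  simpa [show i + (d - i) = d by omega] using this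

/-- Injectivity of multiplication by the power of an ample class, in univariate form. -/
theorem eq_zero_of_homogClass_pow_mul_eq_zero {k₁ k₂ m : ℕ} (hm : 2 * m ≤ k₁ + k₂) {a b : ℝ}
    (ha : a ≠ 0) (hb : b ≠ 0) {p : Polynomial ℝ} (hsupp : p.support ⊆ monomialExponents k₁ k₂ m)
    (h : homogClass k₁ k₂ (k₁ + k₂ - m)
      ((Polynomial.C a * Polynomial.X + Polynomial.C b) ^ (k₁ + k₂ - 2 * m) * p) = 0) :
    p = 0 := by
  set N := k₁ + k₂ - 2 * m with hN
  set ℓ : Polynomial ℝ := Polynomial.C a * Polynomial.X + Polynomial.C b with hℓ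
  have hℓdeg : (ℓ ^ N).natDegree ≤ N := by
    have hdeg : ℓ.natDegree ≤ 1 := Polynomial.natDegree_linear_le
    simpa using Polynomial.natDegree_pow_le_of_le N hdeg
  have hpdeg : p.natDegree ≤ min k₁ m := by
    refine Polynomial.natDegree_le_iff_coeff_eq_zero.mpr fun i hi => ?_
    by_contra hne
    have := hsupp (Polynomial.mem_support_iff.mpr hne)
    rw [monomialExponents, Finset.mem_Icc] at this
    omega
  have hXdvd : Polynomial.X ^ (m - k₂) ∣ p := by
    refine Polynomial.X_pow_dvd_iff.mpr fun i hi => ?_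
    by_contra hne
    have := hsupp (Polynomial.mem_support_iff.mpr hne)
    rw [monomialExponents, Finset.mem_Icc] at this
    omega
  have hsub : (ℓ ^ N * p).support ⊆
      Finset.Icc (m - k₂) (N + min k₁ m) \ monomialExponents k₁ k₂ (k₁ + k₂ - m) := by
    intro i hi
    rw [Polynomial.mem_support_iff] at hi
    rw [Finset.mem_sdiff, Finset.mem_Icc]
    refine ⟨⟨?_, ?_⟩, fun hmem => hi (coeff_eq_zero_of_homogClass_eq_zero h hmem)⟩
    · by_contra hlt
      exact hi (Polynomial.X_pow_dvd_iff.mp (hXdvd.mul_left _) i (by omega))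
    · exact (Polynomial.le_natDegree_of_ne_zero hi).trans
        (Polynomial.natDegree_mul_le.trans (add_le_add hℓdeg hpdeg))
  have hcard : (ℓ ^ N * p).support.card ≤ N := by
    refine (Finset.card_le_card hsub).trans ?_
    rw [monomialExponents, Finset.card_sdiff_of_subset
      (Finset.Icc_subset_Icc (by omega) (by omega)), Nat.card_Icc, Nat.card_Icc]
    omega
  have hℓeq : ℓ = Polynomial.C a * (Polynomial.X - Polynomial.C (-b / a)) := by
    rw [hℓ, mul_sub, ← Polynomial.C_mul, mul_div_cancel₀ _ ha, Polynomial.C_neg, sub_neg_eq_add]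
  have hzero : ℓ ^ N * p = 0 := by
    refine Polynomial.eq_zero_of_X_sub_C_pow_dvd (c := -b / a) (by simp [ha, hb]) N _ ?_ hcard
    rw [hℓeq]
    exact (pow_dvd_pow_of_dvd (dvd_mul_left _ _) N).mul_right p
  refine (mul_eq_zero.mp hzero).resolve_left (pow_ne_zero N ?_)
  rw [hℓeq]
  exact mul_ne_zero (Polynomial.C_ne_zero.mpr ha) (Polynomial.X_sub_C_ne_zero _)

theorem card_monomialExponents_symm {k₁ k₂ m : ℕ} (hm : 2 * m ≤ k₁ + k₂) :
    (monomialExponents k₁ k₂ (k₁ + k₂ - m)).card = (monomialExponents k₁ k₂ m).card := by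
  simp only [monomialExponents, Nat.card_Icc]
  omega

/-- Hard Lefschetz for `ℝ[x,y]/(x^{k₁+1}, y^{k₂+1})`: for `λ = a·x + b·y` with
`a, b > 0` and `0 ≤ m ≤ n/2` (where `n = k₁ + k₂`), multiplication by
`λ^{n-2m}` is a linear isomorphism `R_m → R_{n-m}`. -/
theorem stmt7 (k₁ k₂ : ℕ) (a b : ℝ) (ha : 0 < a) (hb : 0 < b)
    (lam : QR k₁ k₂)
    (hlam : lam = a • Ideal.Quotient.mk (projIdeal k₁ k₂) (X 0)
                + b • Ideal.Quotient.mk (projIdeal k₁ k₂) (X 1))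
    (m : ℕ) (hm : 2 * m ≤ k₁ + k₂) :
    Submodule.map (LinearMap.mulLeft ℝ (lam ^ (k₁ + k₂ - 2 * m))) (Rm k₁ k₂ m)
      = Rm k₁ k₂ (k₁ + k₂ - m) ∧
    ∀ h ∈ Rm k₁ k₂ m, lam ^ (k₁ + k₂ - 2 * m) * h = 0 → h = 0 := by
  set N := k₁ + k₂ - 2 * m with hN
  set ℓ : Polynomial ℝ := Polynomial.C a * Polynomial.X + Polynomial.C b with hℓ
  have hℓdeg : ℓ.natDegree ≤ 1 := Polynomial.natDegree_linear_le
  have hlamℓ : lam = homogClass k₁ k₂ 1 ℓ := by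
    have hX := homogClass_X_pow k₁ k₂ (le_refl 1)
    have h1 := homogClass_X_pow k₁ k₂ (Nat.zero_le 1)
    simp only [pow_one, pow_zero, Nat.sub_self, Nat.sub_zero, mul_one, one_mul] at hX h1
    rw [hlam, hℓ, Polynomial.C_mul', ← mul_one (Polynomial.C b), Polynomial.C_mul', map_add,
      map_smul, map_smul, hX, h1]
  have hmul {p : Polynomial ℝ} (hp : p.natDegree ≤ m) :
      lam ^ N * homogClass k₁ k₂ m p = homogClass k₁ k₂ (k₁ + k₂ - m) (ℓ ^ N * p) := by
    rw [show k₁ + k₂ - m = N + m by omega, homogClass_mul _ _ _ hp, homogClass_pow _ _ hℓdeg,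
      hlamℓ]
    simpa using Polynomial.natDegree_pow_le_of_le N hℓdeg
  have hsum (g : monomialExponents k₁ k₂ m → ℝ)
      (hg : lam ^ N * ∑ i, g i • homogClass k₁ k₂ m (Polynomial.X ^ (i : ℕ)) = 0) : g = 0 := by
    set p : Polynomial ℝ := ∑ i, g i • Polynomial.X ^ (i : ℕ) with hp
    have hcoeff (j : ℕ) : p.coeff j =
        ∑ i : monomialExponents k₁ k₂ m, if j = (i : ℕ) then g i else 0 := by
      simp [hp, Polynomial.finsetSum_coeff, Polynomial.coeff_X_pow]
    have hsupp : p.support ⊆ monomialExponents k₁ k₂ m := by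
      intro j hj
      rw [Polynomial.mem_support_iff, hcoeff] at hj
      obtain ⟨i, -, hi⟩ := Finset.exists_ne_zero_of_sum_ne_zero hj
      rw [of_not_not fun h => hi (if_neg h)]
      exact i.2
    have hdeg : p.natDegree ≤ m := by
      refine Polynomial.natDegree_le_iff_coeff_eq_zero.mpr fun j hj => ?_
      by_contra hne
      have := hsupp (Polynomial.mem_support_iff.mpr hne)
      rw [monomialExponents, Finset.mem_Icc] at this
      omega
    have hp0 : p = 0 := by
      refine eq_zero_of_homogClass_pow_mul_eq_zero hm ha.ne' hb.ne' hsupp ?_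
      rw [← hmul hdeg, hp, map_sum]
      simpa only [map_smul] using hg
    funext i
    have := hcoeff i
    rw [hp0] at this
    simpa [Subtype.coe_inj] using this.symm
  have hspan := Rm_eq_span_range k₁ k₂ m
  constructor
  · have hle : Submodule.map (LinearMap.mulLeft ℝ (lam ^ N)) (Rm k₁ k₂ m) ≤
        Rm k₁ k₂ (k₁ + k₂ - m) := by
      rw [hspan, Submodule.map_span_le]
      rintro _ ⟨i, rfl⟩
      have hi := Finset.mem_Icc.mp i.2
      rw [LinearMap.mulLeft_apply, hmul ((Polynomial.natDegree_X_pow_le _).trans (by omega))]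
      exact homogClass_mem_Rm _ _ _ _
    have hfin : FiniteDimensional ℝ (Rm k₁ k₂ (k₁ + k₂ - m)) := by
      rw [Rm_eq_span_range]
      exact FiniteDimensional.span_of_finite ℝ (Set.finite_range _)
    refine Submodule.eq_of_le_of_finrank_le hle ?_
    have hindep : LinearIndependent ℝ fun i : monomialExponents k₁ k₂ m =>
        LinearMap.mulLeft ℝ (lam ^ N) (homogClass k₁ k₂ m (Polynomial.X ^ (i : ℕ))) := by
      refine Fintype.linearIndependent_iff.mpr fun g hg => congrFun (hsum g ?_)
      simpa only [LinearMap.mulLeft_apply, Finset.mul_sum, mul_smul_comm] using hg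
    have hmap := finrank_span_eq_card hindep
    rw [hspan, Submodule.map_span, ← Set.range_comp, Rm_eq_span_range k₁ k₂ (k₁ + k₂ - m)]
    refine (finrank_range_le_card _).trans (le_of_eq ?_)
    rw [Fintype.card_coe, card_monomialExponents_symm hm, ← Fintype.card_coe]
    exact hmap.symm
  · intro h hh h0
    rw [hspan, Submodule.mem_span_range_iff_exists_fun] at hh
    obtain ⟨g, rfl⟩ := hh
    simp [hsum g h0]
end
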